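/- arXiv:2111.01507 — 2 statements merged into one kernel-verified Lean document; each statement's English description precedes it below -/
import Mathlib

section
/- Let p ≥ 1 and let Σ ∈ ℝ^{p×p} be a symmetric positive definite matrix with eigenvalues λ_1 ≥ λ_2 ≥ ⋯ ≥ λ_p > 0. Fix M ≥ 3, 0 ≤ γ < 1 and 0 < α < 2(1+γ)/λ_1. Then there exists ε > 0 such that for all symmetric matrices Σ̂^{(1)}, …, Σ̂^{(M)} ∈ ℝ^{p×p} with ‖Σ̂^{(m)} − Σ‖ ≤ ε for every m (operator norm), and all vectors b^{(1)}, …, b^{(M)} ∈ ℝ^p: the block matrix Ω built from Δ^{(m)} = (1+γ)I_p − αΣ̂^{(m)} is invertible, and for every choice of initial vectors the FMGDM iterates satisfy θ^{(t,m)} → θ^{(m)} as t → ∞ for each 1 ≤ m ≤ M, where the stable solution θ* = (θ^{(1)ᵀ}, …, θ^{(M)ᵀ})ᵀ = αΩ^{-1}b* with b* = (b^{(1)ᵀ}, …, b^{(M)ᵀ})ᵀ. -/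
set_option autoImplicit false

open Matrix Polynomial Filter

/-- The `M × M` block matrix (with `p × p` blocks) whose `(m, m)` block is `I_p`,
whose `(m, m - 1 mod M)` block is `-Δ m`, whose `(m, m - 2 mod M)` block is `γ • I_p`,
and whose remaining blocks are zero. -/
def blockOmega (M p : ℕ) (γ : ℝ) (Δ : Fin M → Matrix (Fin p) (Fin p) ℝ) :
    Matrix (Fin M × Fin p) (Fin M × Fin p) ℝ :=
  Matrix.of fun x y =>
    if (y.1 : ℕ) = (x.1 : ℕ) then (1 : Matrix (Fin p) (Fin p) ℝ) x.2 y.2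
    else if (y.1 : ℕ) = ((x.1 : ℕ) + (M - 1)) % M then -(Δ x.1 x.2 y.2)
    else if (y.1 : ℕ) = ((x.1 : ℕ) + (M - 2)) % M then
      γ * (1 : Matrix (Fin p) (Fin p) ℝ) x.2 y.2
    else 0

/-- The operator (spectral) norm of a real matrix, i.e. the norm of the induced
continuous linear endomorphism of Euclidean space. -/
noncomputable def matOpNorm {n : Type*} [Fintype n] [DecidableEq n]
    (A : Matrix n n ℝ) : ℝ :=
  ‖(Matrix.toEuclideanCLM (𝕜 := ℝ) A : EuclideanSpace ℝ n →L[ℝ] EuclideanSpace ℝ n)‖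

section Lyapunov

open scoped InnerProductSpace

variable {E : Type*} [NormedAddCommGroup E] [InnerProductSpace ℝ E]

/-- A quadratic Lyapunov function for the two-term recursion `a' = D a - γ b`. -/
noncomputable def momentumEnergy (γ η : ℝ) (D : E →L[ℝ] E) (a b : E) : ℝ :=
  (1 + γ) * (‖a‖ ^ 2 + ‖b‖ ^ 2) - 2 * ⟪a, D b⟫_ℝ - η * ‖b‖ ^ 2

lemma exists_lyapunov_constants {κ δ g : ℝ} (hδ : 0 ≤ δ) (hδκ : δ < κ) (hg : 0 < g) :
    ∃ η > 0, η ≤ (κ - δ) / 2 ∧ ∃ c > 0, ∀ x y w : ℝ, 0 ≤ y → κ * y ≤ w + δ * x →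
      c * (x ^ 2 + y ^ 2) ≤ g * w ^ 2 + η * (x ^ 2 - y ^ 2) := by
  have hκ : 0 < κ := hδ.trans_lt hδκ
  have hd : 0 < κ - δ := sub_pos.2 hδκ
  obtain ⟨K, hK⟩ : ∃ K, K = (1 + κ / (κ - δ)) / κ ^ 2 := ⟨_, rfl⟩
  obtain ⟨q, hq⟩ : ∃ q, q = δ / κ := ⟨_, rfl⟩
  have hK0 : 0 < K := by rw [hK]; positivity
  have hq0 : 0 ≤ q := by rw [hq]; positivity
  have hq1 : q < 1 := by rw [hq]; exact (div_lt_one hκ).2 hδκ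
  obtain ⟨η, hη⟩ : ∃ η, η = min (g / (2 * K)) ((κ - δ) / 2) := ⟨_, rfl⟩
  have hη0 : 0 < η := by rw [hη]; exact lt_min (by positivity) (by positivity)
  have hηK : 2 * η * K ≤ g := by
    have : η ≤ g / (2 * K) := hη ▸ min_le_left _ _
    rw [le_div_iff₀ (by positivity)] at this
    linarith
  refine ⟨η, hη0, hη ▸ min_le_right _ _, η * (1 - q) / 4,
    by have := sub_pos.2 hq1; positivity, fun x y w hy h => ?_⟩
  have hy2 : y ^ 2 ≤ K * w ^ 2 + q * x ^ 2 := by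
    have h1 : (κ * y) ^ 2 ≤ (w + δ * x) ^ 2 := pow_le_pow_left₀ (by positivity) h 2
    have h2 : (w + δ * x) ^ 2 ≤ (1 + κ / (κ - δ)) * w ^ 2 + κ * δ * x ^ 2 := by
      have h3 : (1 + κ / (κ - δ)) * w ^ 2 + κ * δ * x ^ 2 - (w + δ * x) ^ 2
          = (δ * (w - (κ - δ) * x) ^ 2 + (κ - δ) * w ^ 2) / (κ - δ) := by
        field_simp
        ring
      have : 0 ≤ (δ * (w - (κ - δ) * x) ^ 2 + (κ - δ) * w ^ 2) / (κ - δ) := by positivity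
      linarith
    have h4 : K * w ^ 2 + q * x ^ 2
        = ((1 + κ / (κ - δ)) * w ^ 2 + κ * δ * x ^ 2) / κ ^ 2 := by
      rw [hK, hq]
      field_simp
    rw [h4, le_div_iff₀ (by positivity)]
    linarith
  obtain ⟨c, hc⟩ : ∃ c, c = η * (1 - q) / 4 := ⟨_, rfl⟩
  rw [← hc]
  have hc0 : 0 ≤ c := by rw [hc]; have := sub_pos.2 hq1; positivity
  have hcη : c ≤ η := by rw [hc]; nlinarith
  have h5 := mul_le_mul_of_nonneg_left hy2 (add_nonneg hη0.le hc0)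
  have h6 : (η + c) * K * w ^ 2 ≤ g * w ^ 2 := by
    have : (η + c) * K ≤ g := by nlinarith
    gcongr
  have h7 : 0 ≤ (η - c - (η + c) * q) * x ^ 2 := by
    refine mul_nonneg ?_ (sq_nonneg x)
    nlinarith
  nlinarith

lemma momentumEnergy_step (γ η : ℝ) {D : E →L[ℝ] E} (hsymm : ∀ x y, ⟪D x, y⟫_ℝ = ⟪x, D y⟫_ℝ)
    (a b : E) :
    momentumEnergy γ η D (D a - γ • b) a = momentumEnergy γ η D a b
      - ((1 - γ) * ‖D a - (1 + γ) • b‖ ^ 2 + η * (‖a‖ ^ 2 - ‖b‖ ^ 2)) := by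
  simp only [momentumEnergy, ← hsymm a b, ← real_inner_self_eq_norm_sq, inner_sub_left,
    inner_sub_right, inner_smul_left, inner_smul_right, real_inner_comm b (D a),
    RCLike.conj_to_real]
  ring

lemma momentumEnergy_nonneg {γ η δ : ℝ} {D : E →L[ℝ] E} (hD : ∀ x, ‖D x‖ ≤ δ * ‖x‖)
    (hδ : 0 ≤ δ) (hη : 0 ≤ η) (hηδ : η + δ ≤ 1 + γ) (a b : E) :
    0 ≤ momentumEnergy γ η D a b := by
  have h1 : ⟪a, D b⟫_ℝ ≤ ‖a‖ * (δ * ‖b‖) :=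
    (real_inner_le_norm _ _).trans (by gcongr; exact hD b)
  have h2 : 0 ≤ δ * (‖a‖ - ‖b‖) ^ 2 := by positivity
  have h3 := mul_nonneg (sub_nonneg.2 hηδ) (add_nonneg (sq_nonneg ‖a‖) (sq_nonneg ‖b‖))
  have h4 : 0 ≤ η * ‖a‖ ^ 2 := by positivity
  unfold momentumEnergy
  nlinarith

lemma momentumEnergy_add_left_le {γ η δ s : ℝ} {D : E →L[ℝ] E} (hD : ∀ x, ‖D x‖ ≤ δ * ‖x‖)
    (hγ : 0 ≤ γ) (hδ : 0 ≤ δ) (hs0 : 0 ≤ s) (hs1 : s ≤ 1) (a b e : E) (he : ‖e‖ ≤ s * ‖a‖) :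
    momentumEnergy γ η D (D a - γ • b + e) a ≤ momentumEnergy γ η D (D a - γ • b) a
      + s * (((1 + γ) * (2 * δ + γ + 1) + 2 * δ) * (‖a‖ ^ 2 + ‖b‖ ^ 2)) := by
  have h1 : ‖D a - γ • b‖ ≤ δ * ‖a‖ + γ * ‖b‖ := by
    refine (norm_sub_le _ _).trans ?_
    rw [norm_smul, Real.norm_of_nonneg hγ]
    gcongr
    exact hD a
  have h2 : ⟪D a - γ • b, e⟫_ℝ ≤ (δ * ‖a‖ + γ * ‖b‖) * (s * ‖a‖) :=
    (real_inner_le_norm _ _).trans (by gcongr)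
  have h3 : -⟪e, D a⟫_ℝ ≤ (s * ‖a‖) * (δ * ‖a‖) := by
    rw [← inner_neg_left]
    refine (real_inner_le_norm _ _).trans ?_
    rw [norm_neg]
    gcongr
    exact hD a
  have h4 : ‖e‖ ^ 2 ≤ s * ‖a‖ ^ 2 := by
    calc ‖e‖ ^ 2 ≤ (s * ‖a‖) ^ 2 := by gcongr
      _ = s * s * ‖a‖ ^ 2 := by ring
      _ ≤ s * 1 * ‖a‖ ^ 2 := by gcongr
      _ = s * ‖a‖ ^ 2 := by ring
  have h5 : momentumEnergy γ η D (D a - γ • b + e) a = momentumEnergy γ η D (D a - γ • b) a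
      + ((1 + γ) * (2 * ⟪D a - γ • b, e⟫_ℝ + ‖e‖ ^ 2) + 2 * -⟪e, D a⟫_ℝ) := by
    simp only [momentumEnergy, norm_add_sq_real, inner_add_left]
    ring
  rw [h5]
  gcongr
  calc (1 + γ) * (2 * ⟪D a - γ • b, e⟫_ℝ + ‖e‖ ^ 2) + 2 * -⟪e, D a⟫_ℝ
      ≤ (1 + γ) * (2 * ((δ * ‖a‖ + γ * ‖b‖) * (s * ‖a‖)) + s * ‖a‖ ^ 2)
        + 2 * ((s * ‖a‖) * (δ * ‖a‖)) := by gcongr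
    _ ≤ _ := by
      have h6 : 0 ≤ s * ((1 + γ) * (γ * (‖a‖ - ‖b‖) ^ 2)) := by positivity
      have h7 : 0 ≤ s * ((1 + γ) * (2 * δ + 1) + 2 * δ) * ‖b‖ ^ 2 := by positivity
      nlinarith

/-- Homogeneous heavy-ball iterations with time-dependent linear maps close to a fixed
self-adjoint map of norm less than `1 + γ` converge to zero. -/
theorem exists_tendsto_zero_of_perturbed_momentum {γ δ : ℝ} {D : E →L[ℝ] E}
    (hsymm : ∀ x y, ⟪D x, y⟫_ℝ = ⟪x, D y⟫_ℝ) (hD : ∀ x, ‖D x‖ ≤ δ * ‖x‖)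
    (hδ0 : 0 ≤ δ) (hδ : δ < 1 + γ) (hγ0 : 0 ≤ γ) (hγ1 : γ < 1) :
    ∃ ε > 0, ∀ (A : ℕ → E →L[ℝ] E) (v : ℕ → E), (∀ k, ‖A k - D‖ ≤ ε) →
      (∀ k, v (k + 2) = A k (v (k + 1)) - γ • v k) → Tendsto v atTop (nhds 0) := by
  obtain ⟨η, hη0, hηδ, c, hc0, hc⟩ := exists_lyapunov_constants hδ0 hδ (sub_pos.2 hγ1)
  obtain ⟨L, hL⟩ : ∃ L, L = (1 + γ) * (2 * δ + γ + 1) + 2 * δ := ⟨_, rfl⟩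
  have hL0 : 0 < L := by rw [hL]; positivity
  refine ⟨min 1 (c / (2 * L)), by positivity, fun A v hA hv => ?_⟩
  set s := min 1 (c / (2 * L))
  have hs0 : 0 ≤ s := by positivity
  have hsL : s * L ≤ c / 2 := by
    have : s ≤ c / (2 * L) := min_le_right _ _
    rw [le_div_iff₀ (by positivity)] at this
    linarith
  set W : ℕ → ℝ := fun k => momentumEnergy γ η D (v (k + 1)) (v k) with hW
  have hW0 : ∀ k, 0 ≤ W k := fun k =>
    momentumEnergy_nonneg hD hδ0 hη0.le (by linarith) _ _
  have hstep : ∀ k, c / 2 * ‖v k‖ ^ 2 ≤ W k - W (k + 1) := by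
    intro k
    set a := v (k + 1)
    set b := v k
    have he : ‖(A k - D) a‖ ≤ s * ‖a‖ :=
      ((A k - D).le_opNorm a).trans (by gcongr; exact hA k)
    have h1 : v (k + 2) = D a - γ • b + (A k - D) a := by
      rw [hv, _root_.sub_apply]
      abel
    have h2 := momentumEnergy_add_left_le (η := η) hD hγ0 hδ0 hs0 (min_le_left _ _) a b _ he
    rw [← h1, momentumEnergy_step γ η hsymm, ← hL] at h2
    change W (k + 1) ≤ _ at h2
    have h3 : (1 + γ) * ‖b‖ ≤ ‖D a - (1 + γ) • b‖ + δ * ‖a‖ := by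
      have h4 : ‖(1 + γ) • b‖ ≤ ‖D a - (1 + γ) • b‖ + ‖D a‖ := by
        rw [norm_sub_rev]
        linarith [norm_le_norm_add_norm_sub' ((1 + γ) • b) (D a)]
      rw [norm_smul, Real.norm_of_nonneg (by positivity)] at h4
      linarith [hD a]
    have h5 := hc _ _ _ (norm_nonneg b) h3
    have h6 : s * (L * (‖a‖ ^ 2 + ‖b‖ ^ 2)) ≤ c / 2 * (‖a‖ ^ 2 + ‖b‖ ^ 2) := by
      rw [← mul_assoc]
      gcongr
    have h7 : 0 ≤ c / 2 * ‖a‖ ^ 2 := by positivity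
    have h8 : W k = momentumEnergy γ η D a b := rfl
    linarith
  have hsum : Summable fun k => c / 2 * ‖v k‖ ^ 2 := by
    refine summable_of_sum_range_le (c := W 0) (fun k => by positivity) fun n => ?_
    calc ∑ k ∈ Finset.range n, c / 2 * ‖v k‖ ^ 2
        ≤ ∑ k ∈ Finset.range n, (W k - W (k + 1)) := Finset.sum_le_sum fun k _ => hstep k
      _ = W 0 - W n := Finset.sum_range_sub' W n
      _ ≤ W 0 := by linarith [hW0 n]
  have hlim := ((summable_mul_left_iff (by positivity)).1 hsum).tendsto_atTop_zero
  rw [tendsto_zero_iff_norm_tendsto_zero]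
  simpa [Real.sqrt_sq] using hlim.sqrt

end Lyapunov

lemma Matrix.IsHermitian.norm_toEuclideanCLM_smul_one_sub_smul_le {n : Type*} [Fintype n]
    [DecidableEq n] {S : Matrix n n ℝ} (hS : S.IsHermitian) {κ α δ : ℝ} (hδ0 : 0 ≤ δ)
    (hδ : ∀ i, |κ - α * hS.eigenvalues i| ≤ δ) (x : EuclideanSpace ℝ n) :
    ‖toEuclideanCLM (𝕜 := ℝ) (κ • (1 : Matrix n n ℝ) - α • S) x‖ ≤ δ * ‖x‖ := by
  set B := hS.eigenvectorBasis
  have hsymm := isSymmetric_toEuclideanLin_iff.2 hS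
  have hinner : ∀ i, inner ℝ (B i) (toEuclideanCLM (𝕜 := ℝ) (κ • (1 : Matrix n n ℝ) - α • S) x)
      = (κ - α * hS.eigenvalues i) * inner ℝ (B i) x := by
    intro i
    have h1 : toEuclideanLin S (B i) = hS.eigenvalues i • B i := by
      ext j
      exact congrFun (hS.mulVec_eigenvectorBasis i) j
    have h2 : toEuclideanCLM (𝕜 := ℝ) (κ • (1 : Matrix n n ℝ) - α • S) x
        = κ • x - α • toEuclideanLin S x := by
      simp [← coe_toEuclideanCLM_eq_toEuclideanLin]
    rw [h2, inner_sub_right, inner_smul_right, inner_smul_right, ← hsymm, h1, inner_smul_left]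
    simp
    ring
  refine (sq_le_sq₀ (norm_nonneg _) (by positivity)).1 ?_
  rw [mul_pow, ← B.sum_sq_norm_inner_right, ← B.sum_sq_norm_inner_right x, Finset.mul_sum]
  refine Finset.sum_le_sum fun i _ => ?_
  rw [hinner, norm_mul, mul_pow, Real.norm_eq_abs]
  gcongr
  exact hδ i

lemma Matrix.IsHermitian.exists_eigenvalues_eq_of_charpoly_eq_prod {n ι : Type*} [Fintype n]
    [DecidableEq n] [Fintype ι] {S : Matrix n n ℝ} (hS : S.IsHermitian) {lam : ι → ℝ}
    (hchar : S.charpoly = ∏ j, (X - C (lam j))) (i : n) : ∃ j, hS.eigenvalues i = lam j := by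
  have h : (∏ j, (X - C (lam j))).eval (hS.eigenvalues i) = 0 := by
    rw [← hchar, hS.charpoly_eq, eval_prod]
    exact Finset.prod_eq_zero (Finset.mem_univ i) (by simp)
  rw [eval_prod, Finset.prod_eq_zero_iff] at h
  obtain ⟨j, -, hj⟩ := h
  exact ⟨j, by simpa [sub_eq_zero] using hj⟩

lemma blockOmega_mulVec {M p : ℕ} (hM : 3 ≤ M) (γ : ℝ) (Δ : Fin M → Matrix (Fin p) (Fin p) ℝ)
    (θ : Fin M × Fin p → ℝ) (m : Fin M) (i : Fin p) :
    (blockOmega M p γ Δ).mulVec θ (m, i) = θ (m, i)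
      - (Δ m).mulVec (fun j => θ (⟨((m : ℕ) + (M - 1)) % M, Nat.mod_lt _ (by omega)⟩, j)) i
      + γ * θ (⟨((m : ℕ) + (M - 2)) % M, Nat.mod_lt _ (by omega)⟩, i) := by
  set m₁ : Fin M := ⟨((m : ℕ) + (M - 1)) % M, Nat.mod_lt _ (by omega)⟩ with hm₁
  set m₂ : Fin M := ⟨((m : ℕ) + (M - 2)) % M, Nat.mod_lt _ (by omega)⟩ with hm₂
  have hval₁ : (m : ℕ) = 0 ∧ (m₁ : ℕ) = M - 1 ∨ 0 < (m : ℕ) ∧ (m₁ : ℕ) = m - 1 := by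
    have := m.isLt
    rcases Nat.eq_zero_or_pos (m : ℕ) with h | h
    · exact Or.inl ⟨h, by simp only [hm₁, h]; rw [Nat.mod_eq_of_lt] <;> omega⟩
    · refine Or.inr ⟨h, ?_⟩
      simp only [hm₁]
      rw [show (m : ℕ) + (M - 1) = (m - 1) + M by omega, Nat.add_mod_right, Nat.mod_eq_of_lt]
      omega
  have hval₂ : (m : ℕ) < 2 ∧ (m₂ : ℕ) = m + (M - 2) ∨ 2 ≤ (m : ℕ) ∧ (m₂ : ℕ) = m - 2 := by
    have := m.isLt
    rcases Nat.lt_or_ge (m : ℕ) 2 with h | h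
    · exact Or.inl ⟨h, by simp only [hm₂]; rw [Nat.mod_eq_of_lt]; omega⟩
    · refine Or.inr ⟨h, ?_⟩
      simp only [hm₂]
      rw [show (m : ℕ) + (M - 2) = (m - 2) + M by omega, Nat.add_mod_right, Nat.mod_eq_of_lt]
      omega
  have hentry : ∀ (k : Fin M) (j : Fin p), blockOmega M p γ Δ (m, i) (k, j) * θ (k, j)
      = (if k = m then if j = i then θ (m, i) else 0 else 0)
        - (if k = m₁ then Δ m i j * θ (m₁, j) else 0)
        + (if k = m₂ then if j = i then γ * θ (m₂, i) else 0 else 0) := by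
    intro k j
    have h01 : m₁ ≠ m := fun h => by have := congrArg Fin.val h; omega
    have h02 : m₂ ≠ m := fun h => by have := congrArg Fin.val h; omega
    have h12 : m₂ ≠ m₁ := fun h => by have := congrArg Fin.val h; omega
    have e0 : ((k : ℕ) = (m : ℕ)) ↔ k = m := Fin.ext_iff.symm
    have e1 : ((k : ℕ) = ((m : ℕ) + (M - 1)) % M) ↔ k = m₁ := by rw [Fin.ext_iff]
    have e2 : ((k : ℕ) = ((m : ℕ) + (M - 2)) % M) ↔ k = m₂ := by rw [Fin.ext_iff]
    simp only [blockOmega, Matrix.of_apply, e0, e1, e2, Matrix.one_apply, eq_comm (a := i)]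
    clear_value m₁ m₂
    by_cases k0 : k = m
    · subst k0
      by_cases hj : j = i
      · subst hj; simp [h01.symm, h02.symm]
      · simp [hj, h01.symm, h02.symm]
    · by_cases k1 : k = m₁
      · subst k1; simp [h01, h12.symm]
      · by_cases k2 : k = m₂
        · subst k2
          by_cases hj : j = i
          · subst hj; simp [h02, h12]
          · simp [hj, h02, h12]
        · simp [k0, k1, k2]
  simp only [Matrix.mulVec, dotProduct, Fintype.sum_prod_type, hentry, Finset.sum_add_distrib,
    Finset.sum_sub_distrib]
  rw [Finset.sum_comm (f := fun k j => if k = m₁ then _ else _)]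
  simp [Finset.sum_ite_irrel]

/-- Extending a solution of the block system `Ω θ = c` periodically in the block index yields a
solution of the two-term recursion. -/
lemma periodic_extension_of_blockOmega_mulVec_eq {M p : ℕ} (hM : 3 ≤ M) {γ : ℝ}
    {Δ : Fin M → Matrix (Fin p) (Fin p) ℝ} {θ c : Fin M × Fin p → ℝ}
    (h : (blockOmega M p γ Δ).mulVec θ = c) {v : ℕ → Fin p → ℝ}
    (hv : ∀ k j, v k j = θ (⟨(k + (M - 2)) % M, Nat.mod_lt _ (by omega)⟩, j)) (k : ℕ) :
    v (k + 2) = (Δ ⟨k % M, Nat.mod_lt k (by omega)⟩).mulVec (v (k + 1)) - γ • v k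
      + fun j => c (⟨k % M, Nat.mod_lt k (by omega)⟩, j) := by
  have hm : k % M < M := Nat.mod_lt k (by omega)
  have h2 : v (k + 2) = fun j => θ (⟨k % M, hm⟩, j) := by
    ext j
    rw [hv]
    congr 3
    rw [show k + 2 + (M - 2) = k + M by omega, Nat.add_mod_right]
  have h1 : v (k + 1)
      = fun j => θ (⟨(k % M + (M - 1)) % M, Nat.mod_lt _ (by omega)⟩, j) := by
    ext j
    rw [hv]
    congr 3
    rw [Nat.mod_add_mod]
    congr 1
    omega
  have h0 : v k = fun j => θ (⟨(k % M + (M - 2)) % M, Nat.mod_lt _ (by omega)⟩, j) := by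
    ext j
    rw [hv]
    congr 3
    rw [Nat.mod_add_mod]
  ext i
  have := congrFun h (⟨k % M, hm⟩, i)
  rw [blockOmega_mulVec hM] at this
  rw [h2, h1, h0]
  simp only [Pi.add_apply, Pi.sub_apply, Pi.smul_apply, smul_eq_mul]
  linarith

lemma tendsto_mul_add_add_two_atTop {M : ℕ} (hM : M ≠ 0) (m : ℕ) :
    Tendsto (fun t : ℕ => M * t + m + 2) atTop atTop :=
  tendsto_atTop_mono (fun t => by
    have := Nat.le_mul_of_pos_left t (Nat.pos_of_ne_zero hM)
    simp only [id]
    omega) tendsto_id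

lemma mul_add_add_two_add_sub_two_mod {M : ℕ} (hM : 2 ≤ M) (t : ℕ) (m : Fin M) :
    (M * t + (m : ℕ) + 2 + (M - 2)) % M = m := by
  rw [show M * t + (m : ℕ) + 2 + (M - 2) = m + M * (t + 1) by rw [mul_add]; omega,
    Nat.add_mul_mod_self_left, Nat.mod_eq_of_lt m.isLt]

/-- If `0 ≤ γ < 1` and `0 < α < 2(1+γ)/λ_1`, then for all symmetric
`Σ̂^{(m)}` close enough to `Σ` in operator norm and all `b^{(m)}`, the block matrix `Ω`
built from `Δ^{(m)} = (1+γ)I_p − αΣ̂^{(m)}` is invertible, and the FMGDM iterates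
converge to the stable solution `θ* = αΩ⁻¹b*`.  The iterates are flattened into a
sequence `u` with `u 0 = θ^{(0,M-1)}`, `u 1 = θ^{(0,M)}`, and
`u (M(t-1)+m+2) = θ^{(t,m+1)}` (`0`-based minibatch index `m`). -/
theorem stmt11 (p M : ℕ) (hp : 1 ≤ p) (hM : 3 ≤ M)
    (S : Matrix (Fin p) (Fin p) ℝ) (hsymm : S.IsSymm)
    (lam : Fin p → ℝ) (hmono : Antitone lam) (hpos : ∀ j, 0 < lam j)
    (hchar : S.charpoly = ∏ j : Fin p, (X - C (lam j)))
    (γ α : ℝ) (hγ0 : 0 ≤ γ) (hγ1 : γ < 1)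
    (hα0 : 0 < α) (hα1 : α < 2 * (1 + γ) / lam ⟨0, hp⟩) :
    ∃ ε > 0, ∀ Shat : Fin M → Matrix (Fin p) (Fin p) ℝ,
      (∀ m, (Shat m).IsSymm) → (∀ m, matOpNorm (Shat m - S) ≤ ε) →
      ∀ b : Fin M → (Fin p → ℝ),
        IsUnit (blockOmega M p γ
          (fun m => (1 + γ) • (1 : Matrix (Fin p) (Fin p) ℝ) - α • Shat m)) ∧
        ∀ u : ℕ → (Fin p → ℝ),
          (∀ k : ℕ,
            u (k + 2) =
              ((1 + γ) • (1 : Matrix (Fin p) (Fin p) ℝ)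
                  - α • Shat ⟨k % M, Nat.mod_lt k (by omega)⟩).mulVec (u (k + 1))
                - γ • u k + α • b ⟨k % M, Nat.mod_lt k (by omega)⟩) →
          ∀ m : Fin M,
            Tendsto (fun t : ℕ => u (M * t + (m : ℕ) + 2)) atTop
              (nhds (fun i : Fin p =>
                (α • (blockOmega M p γ
                    (fun m' => (1 + γ) • (1 : Matrix (Fin p) (Fin p) ℝ)
                      - α • Shat m'))⁻¹.mulVec (fun x => b x.1 x.2)) (m, i))) := by
  have hS : S.IsHermitian := by
    rw [IsHermitian, conjTranspose_eq_transpose_of_trivial]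
    exact hsymm
  have : Nonempty (Fin p) := ⟨⟨0, hp⟩⟩
  obtain ⟨i₀, hi₀⟩ := Finite.exists_max fun i => |(1 + γ) - α * hS.eigenvalues i|
  have hδ : |(1 + γ) - α * hS.eigenvalues i₀| < 1 + γ := by
    obtain ⟨j, hj⟩ := hS.exists_eigenvalues_eq_of_charpoly_eq_prod hchar i₀
    have h1 : lam j ≤ lam ⟨0, hp⟩ := hmono (Nat.zero_le _)
    rw [lt_div_iff₀ (hpos _)] at hα1
    have h2 : 0 < α * lam j := mul_pos hα0 (hpos j)
    have h3 : α * lam j ≤ α * lam ⟨0, hp⟩ := mul_le_mul_of_nonneg_left h1 hα0.le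
    rw [hj, abs_lt]
    constructor <;> linarith
  have hDsymm :
      (toEuclideanLin ((1 + γ) • (1 : Matrix (Fin p) (Fin p) ℝ) - α • S)).IsSymmetric := by
    rw [isSymmetric_toEuclideanLin_iff]
    exact (isHermitian_one.smul (.all _)).sub (hS.smul (.all _))
  obtain ⟨ε, hε, hconv⟩ := exists_tendsto_zero_of_perturbed_momentum
    (D := toEuclideanCLM (𝕜 := ℝ) ((1 + γ) • (1 : Matrix (Fin p) (Fin p) ℝ) - α • S))
    hDsymm (hS.norm_toEuclideanCLM_smul_one_sub_smul_le (abs_nonneg _) hi₀) (abs_nonneg _) hδ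
    hγ0 hγ1
  refine ⟨ε / α, by positivity, fun Shat _ hShat b => ?_⟩
  set Δ : Fin M → Matrix (Fin p) (Fin p) ℝ :=
    fun m => (1 + γ) • (1 : Matrix (Fin p) (Fin p) ℝ) - α • Shat m with hΔ
  have hzero : ∀ v : ℕ → Fin p → ℝ,
      (∀ k, v (k + 2) = (Δ ⟨k % M, Nat.mod_lt k (by omega)⟩).mulVec (v (k + 1)) - γ • v k) →
      Tendsto v atTop (nhds 0) := by
    intro v hv
    have h := hconv (fun k => toEuclideanCLM (𝕜 := ℝ) (Δ ⟨k % M, Nat.mod_lt k (by omega)⟩))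
      (fun k => WithLp.toLp 2 (v k)) (fun k => ?_) (fun k => ?_)
    · exact ((PiLp.continuous_ofLp 2 _).tendsto _).comp h
    · have h1 : ∀ m, Δ m - ((1 + γ) • (1 : Matrix (Fin p) (Fin p) ℝ) - α • S)
          = (-α) • (Shat m - S) := by
        intro m
        simp only [hΔ, smul_sub, neg_smul]
        abel
      rw [← map_sub, h1, map_smul, norm_smul, norm_neg, Real.norm_of_nonneg hα0.le]
      have h2 := hShat ⟨k % M, Nat.mod_lt k (by omega)⟩
      rw [le_div_iff₀ hα0, mul_comm] at h2
      exact h2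
    · simp [hv]
  have hunit : IsUnit (blockOmega M p γ Δ) := by
    rw [← mulVec_injective_iff_isUnit]
    refine (injective_iff_map_eq_zero (blockOmega M p γ Δ).mulVecLin).2 fun θ hθ => ?_
    have hlim := hzero (fun k j => θ (⟨(k + (M - 2)) % M, Nat.mod_lt _ (by omega)⟩, j))
      fun k => by
        rw [periodic_extension_of_blockOmega_mulVec_eq hM hθ fun _ _ => rfl]
        ext j
        simp
    ext ⟨m, i⟩
    have hsub := tendsto_pi_nhds.1 (hlim.comp (tendsto_mul_add_add_two_atTop (M := M) (by omega) m)) i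
    refine tendsto_nhds_unique (tendsto_const_nhds.congr fun t => ?_) hsub
    simp [mul_add_add_two_add_sub_two_mod (M := M) (by omega)]
  refine ⟨hunit, fun u hu m => ?_⟩
  set θ := α • (blockOmega M p γ Δ)⁻¹.mulVec (fun x => b x.1 x.2) with hθ
  have hθeq : (blockOmega M p γ Δ).mulVec θ = α • fun x => b x.1 x.2 := by
    rw [hθ, mulVec_smul, mulVec_mulVec, mul_nonsing_inv _ ((isUnit_iff_isUnit_det _).1 hunit),
      one_mulVec]
  set w : ℕ → Fin p → ℝ := fun k j => θ (⟨(k + (M - 2)) % M, Nat.mod_lt _ (by omega)⟩, j)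
    with hw
  have hlim := hzero (fun k => u k - w k) fun k => by
    rw [hu, periodic_extension_of_blockOmega_mulVec_eq (v := w) hM hθeq fun _ _ => rfl,
      mulVec_sub, smul_sub]
    ext j
    simp [hΔ, hw]
    ring
  have hsub := (hlim.comp (tendsto_mul_add_add_two_atTop (M := M) (by omega) m)).add_const
    fun i => θ (m, i)
  rw [zero_add] at hsub
  refine hsub.congr fun t => ?_
  ext i
  simp [hw, mul_add_add_two_add_sub_two_mod (M := M) (by omega)]
end

section
/- Let M ≥ 3, p ≥ 1, q = Mp, and γ ≥ 0 with γ ≠ 1. Let Σ ∈ ℝ^{p×p} be symmetric positive definite. Let A ∈ ℝ^{q×q} be the M×M block matrix (p×p blocks) whose (m,m) block is I_p, whose (m, m−1 mod M) block is −(1+γ)I_p, whose (m, m−2 mod M) block is γI_p, and whose remaining blocks are zero; let B ∈ ℝ^{q×q} be the block matrix whose (m, m−1 mod M) block is Σ and whose other blocks are zero; and set Ω(α) = A + αB for α ∈ ℝ. Then there exists α_0 > 0 such that Ω(α) is invertible for all 0 < α < α_0, and α² Ω(α)^{-1} (I_M ⊗ Σ) (Ω(α)^{-1})ᵀ → M^{-1}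 (1_M 1_Mᵀ) ⊗ Σ^{-1} as α → 0⁺. -/
set_option autoImplicit false

open Matrix Filter

/-- The `M × M` block matrix `A` (with `p × p` blocks) whose `(m, m)` block is `I_p`,
whose `(m, m - 1 mod M)` block is `-(1+γ) I_p`, whose `(m, m - 2 mod M)` block is
`γ I_p`, and whose remaining blocks are zero. -/
def blockA (M p : ℕ) (γ : ℝ) : Matrix (Fin M × Fin p) (Fin M × Fin p) ℝ :=
  Matrix.of fun x y =>
    if (y.1 : ℕ) = (x.1 : ℕ) then (1 : Matrix (Fin p) (Fin p) ℝ) x.2 y.2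
    else if (y.1 : ℕ) = ((x.1 : ℕ) + (M - 1)) % M then
      -((1 + γ) * (1 : Matrix (Fin p) (Fin p) ℝ) x.2 y.2)
    else if (y.1 : ℕ) = ((x.1 : ℕ) + (M - 2)) % M then
      γ * (1 : Matrix (Fin p) (Fin p) ℝ) x.2 y.2
    else 0

/-- The `M × M` block matrix `B` whose `(m, m - 1 mod M)` block is `Σ` and whose other
blocks are zero. -/
def blockBconst (M p : ℕ) (S : Matrix (Fin p) (Fin p) ℝ) :
    Matrix (Fin M × Fin p) (Fin M × Fin p) ℝ :=
  Matrix.of fun x y =>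
    if (y.1 : ℕ) = ((x.1 : ℕ) + (M - 1)) % M then S x.2 y.2 else 0

open scoped Kronecker

/-- The cyclic shift matrix: `(cyclicShift M *ᵥ v) m = v (m - 1)`. -/
def cyclicShift (M : ℕ) [NeZero M] : Matrix (Fin M) (Fin M) ℝ :=
  Matrix.of fun i j => if j = i - 1 then 1 else 0

/-- The averaging matrix, all of whose entries are `M⁻¹`. -/
noncomputable def averaging (M : ℕ) : Matrix (Fin M) (Fin M) ℝ :=
  Matrix.of fun _ _ => (M : ℝ)⁻¹

theorem averaging_transpose (M : ℕ) : (averaging M)ᵀ = averaging M := rfl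

section Cyclic

variable {M : ℕ} [NeZero M]

theorem cyclicShift_mul_averaging : cyclicShift M * averaging M = averaging M := by
  ext i j
  simp [Matrix.mul_apply, cyclicShift, averaging]

theorem averaging_mul_cyclicShift : averaging M * cyclicShift M = averaging M := by
  ext i j
  have h (k : Fin M) : (j = k - 1) ↔ (k = j + 1) := by
    rw [eq_sub_iff_add_eq, eq_comm]
  simp [Matrix.mul_apply, cyclicShift, averaging, h]

theorem averaging_mul_averaging : averaging M * averaging M = averaging M := by
  ext i j
  have : (M : ℝ) ≠ 0 := by exact_mod_cast NeZero.ne M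
  simp [Matrix.mul_apply, averaging]
  field_simp

theorem Fin.val_eq_add_sub_mod_iff {k : ℕ} (hk : k < M) (i j : Fin M) :
    (j : ℕ) = ((i : ℕ) + (M - k)) % M ↔ j = i - Fin.ofNat M k := by
  rw [Fin.ext_iff, Fin.sub_def]
  simp [Nat.mod_eq_of_lt hk, add_comm]

theorem blockBconst_eq_kronecker (hM : 3 ≤ M) (p : ℕ) (S : Matrix (Fin p) (Fin p) ℝ) :
    blockBconst M p S = cyclicShift M ⊗ₖ S := by
  ext ⟨m, i⟩ ⟨n, j⟩
  have h1 : (n : ℕ) = ((m : ℕ) + (M - 1)) % M ↔ n = m - 1 :=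
    Fin.val_eq_add_sub_mod_iff (show 1 < M by omega) m n
  simp [blockBconst, cyclicShift, h1]

theorem blockA_eq_kronecker (hM : 3 ≤ M) (p : ℕ) (γ : ℝ) :
    blockA M p γ = 1 - (1 + γ) • (cyclicShift M ⊗ₖ (1 : Matrix (Fin p) (Fin p) ℝ)) +
      γ • ((cyclicShift M * cyclicShift M) ⊗ₖ (1 : Matrix (Fin p) (Fin p) ℝ)) := by
  ext ⟨m, i⟩ ⟨n, j⟩
  have h1 : (n : ℕ) = ((m : ℕ) + (M - 1)) % M ↔ n = m - 1 :=
    Fin.val_eq_add_sub_mod_iff (show 1 < M by omega) m n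
  have h2 := Fin.val_eq_add_sub_mod_iff (show 2 < M by omega) m n
  have hsub : m - 1 - 1 = m - Fin.ofNat M 2 := by
    rw [sub_sub]
    congr 1
    ext
    simp [Fin.val_add]
  have d1 : m - 1 ≠ m := by
    intro h
    have := congrArg Fin.val (sub_eq_self.mp h)
    simp [Nat.mod_eq_of_lt (show 1 < M by omega)] at this
  have d2 : m - Fin.ofNat M 2 ≠ m := by
    intro h
    have := congrArg Fin.val (sub_eq_self.mp h)
    simp [Nat.mod_eq_of_lt (show 2 < M by omega)] at this
  have d3 : m - Fin.ofNat M 2 ≠ m - 1 := by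
    rw [← hsub]
    intro h
    have := congrArg Fin.val (sub_eq_self.mp h)
    simp [Nat.mod_eq_of_lt (show 1 < M by omega)] at this
  have hone : (1 : Matrix (Fin M × Fin p) (Fin M × Fin p) ℝ) =
      (1 : Matrix (Fin M) (Fin M) ℝ) ⊗ₖ (1 : Matrix (Fin p) (Fin p) ℝ) :=
    one_kronecker_one.symm
  have hsq : (cyclicShift M * cyclicShift M) m n =
      if n = m - Fin.ofNat M 2 then 1 else 0 := by
    rw [← hsub, Matrix.mul_apply]
    simp only [cyclicShift, Matrix.of_apply, ite_mul, one_mul, zero_mul, Finset.sum_ite_eq',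
      Finset.mem_univ, if_true]
  rw [hone]
  simp only [blockA, Matrix.of_apply, Matrix.add_apply, Matrix.sub_apply, Matrix.smul_apply,
    kroneckerMap_apply, hsq, h1, h2, smul_eq_mul, ← Fin.ext_iff]
  rw [show cyclicShift M m n = if n = m - 1 then 1 else 0 from rfl, Matrix.one_apply (i := m)]
  by_cases c0 : n = m
  · subst c0
    simp only [d1.symm, d2.symm, if_true, if_false]
    ring
  · by_cases c1 : n = m - 1
    · subst c1
      simp only [c0, d1.symm, d3.symm, if_true, if_false]
      ring
    · simp only [c0, c1, Ne.symm c0, if_false]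
      split_ifs <;> ring

variable {p : ℕ}

theorem cyclicShift_kronecker_one_mulVec (x : Fin M × Fin p → ℝ) (m : Fin M) (i : Fin p) :
    ((cyclicShift M ⊗ₖ (1 : Matrix (Fin p) (Fin p) ℝ)) *ᵥ x) (m, i) = x (m - 1, i) := by
  simp [Matrix.mulVec, dotProduct, Fintype.sum_prod_type, cyclicShift, Matrix.one_apply]

theorem eq_zero_of_eq_smul_cyclicShift {γ : ℝ} (hγ0 : 0 ≤ γ) (hγ1 : γ ≠ 1)
    {y : Fin M × Fin p → ℝ} (hy : ∀ m i, y (m, i) = γ * y (m - 1, i)) : y = 0 := by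
  ext ⟨m, i⟩
  have hsum : ∑ m, y (m, i) ^ 2 = γ ^ 2 * ∑ m, y (m, i) ^ 2 := by
    calc ∑ m, y (m, i) ^ 2 = ∑ m, γ ^ 2 * y (m - 1, i) ^ 2 :=
          Finset.sum_congr rfl fun m _ => by rw [hy m i, mul_pow]
      _ = γ ^ 2 * ∑ m, y (m - 1, i) ^ 2 := by rw [Finset.mul_sum]
      _ = γ ^ 2 * ∑ m, y (m, i) ^ 2 := by
          congr 1
          exact (Equiv.subRight (1 : Fin M)).sum_comp (fun m => y (m, i) ^ 2)
  have hγ : 1 - γ ^ 2 ≠ 0 := by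
    intro h
    have : (1 - γ) * (1 + γ) = 0 := by linarith
    rcases mul_eq_zero.mp this with h | h
    · exact hγ1 (by linarith)
    · linarith
  have h0 : ∑ m, y (m, i) ^ 2 = 0 := by
    refine (mul_eq_zero.mp (?_ : (1 - γ ^ 2) * _ = 0)).resolve_left hγ
    linarith
  have := (Finset.sum_eq_zero_iff_of_nonneg fun m _ => sq_nonneg (y (m, i))).mp h0 m
    (Finset.mem_univ m)
  simpa using this

theorem averaging_kronecker_one_mulVec_of_shift_invariant {x : Fin M × Fin p → ℝ}
    (hx : ∀ m i, x (m, i) = x (m - 1, i)) :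
    (averaging M ⊗ₖ (1 : Matrix (Fin p) (Fin p) ℝ)) *ᵥ x = x := by
  have hconst : ∀ m i, x (m, i) = x (0, i) := by
    intro m i
    obtain ⟨k, hk⟩ := m
    induction k with
    | zero => rfl
    | succ k ih =>
      rw [hx, ← ih (by omega)]
      congr 2
      rw [sub_eq_iff_eq_add]
      ext
      simp [Fin.val_add, Nat.mod_eq_of_lt hk]
  have hM : (M : ℝ) ≠ 0 := by exact_mod_cast NeZero.ne M
  ext ⟨m, i⟩
  simp [Matrix.mulVec, dotProduct, Fintype.sum_prod_type, averaging, Matrix.one_apply,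
    hconst _ i, hM]

theorem averaging_mulVec_of_blockA_mulVec_eq_zero (hM : 3 ≤ M) {γ : ℝ} (hγ0 : 0 ≤ γ)
    (hγ1 : γ ≠ 1) {x : Fin M × Fin p → ℝ} (hx : blockA M p γ *ᵥ x = 0) :
    (averaging M ⊗ₖ (1 : Matrix (Fin p) (Fin p) ℝ)) *ᵥ x = x := by
  apply averaging_kronecker_one_mulVec_of_shift_invariant
  have hsq : (cyclicShift M * cyclicShift M) ⊗ₖ (1 : Matrix (Fin p) (Fin p) ℝ) =
      (cyclicShift M ⊗ₖ 1) * (cyclicShift M ⊗ₖ 1) := by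
    rw [← mul_kronecker_mul, one_mul]
  have hy := eq_zero_of_eq_smul_cyclicShift hγ0 hγ1 (y := fun z => x z - x (z.1 - 1, z.2))
    (fun m i => by
      have h := congrFun hx (m, i)
      rw [blockA_eq_kronecker hM, hsq] at h
      simp only [add_mulVec, sub_mulVec, smul_mulVec, one_mulVec, ← mulVec_mulVec,
        Pi.add_apply, Pi.sub_apply, Pi.smul_apply, cyclicShift_kronecker_one_mulVec,
        Pi.zero_apply, smul_eq_mul] at h
      linarith)
  intro m i
  exact sub_eq_zero.mp (congrFun hy (m, i))

end Cyclic

/-- If `P * A = 0` and `A + P * B` is invertible, then `A + α • B` is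
invertible for small `α > 0`, and `α • (A + α • B)⁻¹` tends to `(A + P * B)⁻¹ * P` as `α → 0⁺`. -/
theorem singular_perturbation_inverse {n : Type*} [Fintype n] [DecidableEq n]
    (A B P : Matrix n n ℝ) (hPA : P * A = 0)
    (hdet : (A + P * B).det ≠ 0) :
    (∀ᶠ α in nhdsWithin (0 : ℝ) (Set.Ioi 0), IsUnit (A + α • B)) ∧
      Tendsto (fun α : ℝ => α • (A + α • B)⁻¹) (nhdsWithin 0 (Set.Ioi 0))
        (nhds ((A + P * B)⁻¹ * P)) := by
  set N : ℝ → Matrix n n ℝ := fun α => A + P * B + α • ((1 - P) * B) with hN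
  set U : ℝ → Matrix n n ℝ := fun α => α • (1 - P) + P with hU
  have hN0 : N 0 = A + P * B := by simp [hN]
  have hU0 : U 0 = P := by simp [hU]
  have hNc : Continuous N := by fun_prop
  have hUc : Continuous U := by fun_prop
  have hUN (α : ℝ) : U α * (A + α • B) = α • N α := by
    simp only [hU, hN, add_mul, mul_add, sub_mul, smul_mul_assoc, mul_smul_comm, one_mul, hPA]
    module
  have hNdet : ∀ᶠ α in nhdsWithin (0 : ℝ) (Set.Ioi 0), (N α).det ≠ 0 := by
    refine nhdsWithin_le_nhds ?_
    have hc : ContinuousAt (fun α => (N α).det) 0 := hNc.matrix_det.continuousAt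
    exact hc.eventually_ne (by rwa [hN0])
  have hgood : ∀ᶠ α in nhdsWithin (0 : ℝ) (Set.Ioi 0),
      0 < α ∧ (N α).det ≠ 0 ∧ (A + α • B).det ≠ 0 := by
    filter_upwards [hNdet, self_mem_nhdsWithin] with α hα hpos
    refine ⟨hpos, hα, fun h => ?_⟩
    have hd := congrArg Matrix.det (hUN α)
    rw [det_mul, h, mul_zero, det_smul] at hd
    exact mul_ne_zero (pow_ne_zero _ (ne_of_gt hpos)) hα hd.symm
  refine ⟨?_, ?_⟩
  · filter_upwards [hgood] with α hα
    exact (Matrix.isUnit_iff_isUnit_det _).mpr (isUnit_iff_ne_zero.mpr hα.2.2)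
  · have hlim : Tendsto (fun α => (N α)⁻¹ * U α) (nhdsWithin 0 (Set.Ioi 0))
        (nhds ((A + P * B)⁻¹ * P)) := by
      have hinv : ContinuousAt (fun α => (N α)⁻¹) 0 := by
        simp only [Matrix.inv_def, Ring.inverse_eq_inv']
        exact (hNc.matrix_det.continuousAt.inv₀ (by rwa [hN0])).smul
          hNc.matrix_adjugate.continuousAt
      rw [← hN0, show (N 0)⁻¹ * P = (N 0)⁻¹ * U 0 by rw [hU0]]
      exact (hinv.mul hUc.continuousAt).tendsto.mono_left nhdsWithin_le_nhds
    refine hlim.congr' ?_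
    filter_upwards [hgood] with α ⟨_, hNα, hKα⟩
    have hNu := isUnit_iff_ne_zero.mpr hNα
    have hKu := isUnit_iff_ne_zero.mpr hKα
    calc (N α)⁻¹ * U α = (N α)⁻¹ * (U α * (A + α • B) * (A + α • B)⁻¹) := by
          rw [Matrix.mul_nonsing_inv_cancel_right _ _ hKu]
      _ = α • ((N α)⁻¹ * (N α * (A + α • B)⁻¹)) := by
          rw [hUN, smul_mul_assoc, mul_smul_comm]
      _ = α • (A + α • B)⁻¹ := by rw [Matrix.nonsing_inv_mul_cancel_left _ _ hNu]

/-- With `Ω(α) = A + αB`, there is `α₀ > 0` such that `Ω(α)` is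
invertible for `0 < α < α₀`, and
`α² Ω(α)⁻¹ (I_M ⊗ Σ) (Ω(α)⁻¹)ᵀ → M⁻¹ (1_M 1_Mᵀ) ⊗ Σ⁻¹` as `α → 0⁺`
(entrywise convergence of matrices). -/
theorem stmt18 (M p : ℕ) (hM : 3 ≤ M) (hp : 1 ≤ p)
    (γ : ℝ) (hγ0 : 0 ≤ γ) (hγ1 : γ ≠ 1)
    (S : Matrix (Fin p) (Fin p) ℝ) (hpd : S.PosDef) :
    (∃ α₀ > (0 : ℝ), ∀ α : ℝ, 0 < α → α < α₀ →
      IsUnit (blockA M p γ + α • blockBconst M p S)) ∧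
    Tendsto
      (fun α : ℝ =>
        (α ^ 2) •
          ((blockA M p γ + α • blockBconst M p S)⁻¹ *
            (Matrix.of fun x y : Fin M × Fin p =>
              if y.1 = x.1 then S x.2 y.2 else 0) *
            ((blockA M p γ + α • blockBconst M p S)⁻¹)ᵀ))
      (nhdsWithin 0 (Set.Ioi 0))
      (nhds (Matrix.of fun x y : Fin M × Fin p => (M : ℝ)⁻¹ * S⁻¹ x.2 y.2)) := by
  have : NeZero M := ⟨by omega⟩
  set A := blockA M p γ with hA
  set B := blockBconst M p S with hB
  set P : Matrix (Fin M × Fin p) (Fin M × Fin p) ℝ := averaging M ⊗ₖ 1 with hP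
  have hSdet : IsUnit S.det := (Matrix.isUnit_iff_isUnit_det _).mp hpd.isUnit
  have hPP : P * P = P := by
    rw [hP, ← mul_kronecker_mul, averaging_mul_averaging, one_mul]
  have hPA : P * A = 0 := by
    rw [hP, hA, blockA_eq_kronecker hM, mul_add, mul_sub, mul_smul_comm, mul_smul_comm,
      ← mul_kronecker_mul, ← mul_kronecker_mul, ← mul_assoc, averaging_mul_cyclicShift,
      averaging_mul_cyclicShift, one_mul, mul_one]
    module
  have hAE (T : Matrix (Fin p) (Fin p) ℝ) : A * (averaging M ⊗ₖ T) = 0 := by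
    rw [hA, blockA_eq_kronecker hM, add_mul, sub_mul, smul_mul_assoc, smul_mul_assoc,
      ← mul_kronecker_mul, ← mul_kronecker_mul, mul_assoc, cyclicShift_mul_averaging,
      cyclicShift_mul_averaging, one_mul, one_mul]
    module
  have hPB : P * B = averaging M ⊗ₖ S := by
    rw [hP, hB, blockBconst_eq_kronecker hM, ← mul_kronecker_mul, averaging_mul_cyclicShift,
      one_mul]
  have hdet : (A + P * B).det ≠ 0 := by
    intro h
    obtain ⟨x, hx0, hx⟩ := Matrix.exists_mulVec_eq_zero_iff.mpr h
    have hPBx : (P * B) *ᵥ x = 0 := by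
      have := congrArg (P *ᵥ ·) hx
      simpa only [mulVec_mulVec, mul_add, hPA, zero_add, ← mul_assoc, hPP, mulVec_zero]
        using this
    have hAx : A *ᵥ x = 0 := by simpa [add_mulVec, hPBx] using hx
    have hPx := averaging_mulVec_of_blockA_mulVec_eq_zero hM hγ0 hγ1 hAx
    apply hx0
    have hinv : ((1 : Matrix (Fin M) (Fin M) ℝ) ⊗ₖ S⁻¹) * (P * B) = P := by
      rw [hPB, ← mul_kronecker_mul, one_mul, Matrix.nonsing_inv_mul _ hSdet]
    rw [← hPx, ← hP, ← hinv, ← mulVec_mulVec, hPBx, mulVec_zero]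
  obtain ⟨hunit, hlim⟩ := singular_perturbation_inverse A B P hPA hdet
  have hL : (A + P * B)⁻¹ * P = averaging M ⊗ₖ S⁻¹ := by
    have : (A + P * B) * (averaging M ⊗ₖ S⁻¹) = P := by
      rw [add_mul, hAE, zero_add, hPB, ← mul_kronecker_mul, averaging_mul_averaging,
        Matrix.mul_nonsing_inv _ hSdet]
    calc (A + P * B)⁻¹ * P = (A + P * B)⁻¹ * ((A + P * B) * (averaging M ⊗ₖ S⁻¹)) := by
          rw [this]
      _ = averaging M ⊗ₖ S⁻¹ :=
          Matrix.nonsing_inv_mul_cancel_left _ _ (isUnit_iff_ne_zero.mpr hdet)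
  rw [hL] at hlim
  refine ⟨?_, ?_⟩
  · obtain ⟨α₀, hα₀, h⟩ := mem_nhdsGT_iff_exists_Ioo_subset.mp hunit
    exact ⟨α₀, hα₀, fun α h0 h1 => h ⟨h0, h1⟩⟩
  · have hD : (Matrix.of fun x y : Fin M × Fin p => if y.1 = x.1 then S x.2 y.2 else 0) =
        (1 : Matrix (Fin M) (Fin M) ℝ) ⊗ₖ S := by
      ext x y
      simp [Matrix.one_apply, eq_comm]
    have hS : (S⁻¹)ᵀ = S⁻¹ := by
      rw [Matrix.transpose_nonsing_inv]
      congr 1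
      simpa using hpd.isHermitian.eq
    have hR : (Matrix.of fun x y : Fin M × Fin p => (M : ℝ)⁻¹ * S⁻¹ x.2 y.2) =
        (averaging M ⊗ₖ S⁻¹) * ((1 : Matrix (Fin M) (Fin M) ℝ) ⊗ₖ S) *
          (averaging M ⊗ₖ S⁻¹)ᵀ := by
      rw [← kroneckerMap_transpose, averaging_transpose, hS, ← mul_kronecker_mul,
        ← mul_kronecker_mul, mul_one, averaging_mul_averaging,
        Matrix.nonsing_inv_mul _ hSdet, one_mul]
      rfl
    rw [hD, hR]
    have htr : Tendsto (fun α : ℝ => (α • (A + α • B)⁻¹)ᵀ) (nhdsWithin 0 (Set.Ioi 0))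
        (nhds (averaging M ⊗ₖ S⁻¹)ᵀ) :=
      (continuous_id.matrix_transpose.tendsto _).comp hlim
    refine ((hlim.mul_const _).mul htr).congr fun α => ?_
    rw [transpose_smul, smul_mul_assoc, smul_mul_assoc, mul_smul_comm, smul_smul, sq]
end
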